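/- arXiv:1506.06186 — 4 statements merged into one kernel-verified Lean document; each statement's English description precedes it below -/
import Mathlib

section
/- For every integer k ≥ 1, k times the sum Σ_{j=0}^{k−1} T_j of the first k triangular numbers equals the maximum of the sizes of all simultaneous (2k−1, 2k, 2k+1)-core partitions. -/
/-- The hook length of the cell `(i, j)` (0-indexed) of a Young diagram. -/
def YoungDiagram.hookLength (Y : YoungDiagram) (i j : ℕ) : ℕ :=
  Y.rowLen i - j + (Y.colLen j - i) - 1

/-- A Young diagram (partition) is a `t`-core if no cell has hook length `t`. -/
def YoungDiagram.IsCore (Y : YoungDiagram) (t : ℕ) : Prop :=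
  ∀ c ∈ Y.cells, Y.hookLength c.1 c.2 ≠ t

open Finset

namespace YoungDiagram

/-! ### Beta-sets -/

/-- The `i`-th first-column hook length (beta-number) of a Young diagram. -/
def beta (Y : YoungDiagram) (i : ℕ) : ℕ :=
  Y.rowLen i + (Y.colLen 0 - 1 - i)

/-- The set of first-column hook lengths of a Young diagram. -/
def betaSet (Y : YoungDiagram) : Finset ℕ :=
  (range (Y.colLen 0)).image Y.beta

theorem rowLen_pos_iff (Y : YoungDiagram) (i : ℕ) : 0 < Y.rowLen i ↔ i < Y.colLen 0 := by
  rw [← mem_iff_lt_rowLen, mem_iff_lt_colLen]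

theorem beta_injOn (Y : YoungDiagram) : Set.InjOn Y.beta (range (Y.colLen 0)) := by
  intro i hi j hj h
  simp only [coe_range, Set.mem_Iio] at hi hj
  simp only [beta] at h
  rcases lt_trichotomy i j with hij | hij | hij
  · have := Y.rowLen_anti i j hij.le
    omega
  · exact hij
  · have := Y.rowLen_anti j i hij.le
    omega

theorem card_betaSet (Y : YoungDiagram) : Y.betaSet.card = Y.colLen 0 := by
  rw [betaSet, card_image_of_injOn Y.beta_injOn, card_range]

theorem zero_notMem_betaSet (Y : YoungDiagram) : 0 ∉ Y.betaSet := by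
  simp only [betaSet, mem_image, mem_range, not_exists, not_and]
  intro i hi h
  have := (Y.rowLen_pos_iff i).2 hi
  simp only [beta] at h
  omega

theorem card_eq_sum_rowLen (Y : YoungDiagram) : Y.card = ∑ i ∈ range (Y.colLen 0), Y.rowLen i := by
  have h : ∀ c ∈ Y.cells, c.1 ∈ range (Y.colLen 0) := by
    intro c hc
    rw [mem_range, ← mem_iff_lt_colLen]
    exact Y.up_left_mem le_rfl (Nat.zero_le c.2) hc
  rw [YoungDiagram.card, card_eq_sum_card_fiberwise h]
  exact sum_congr rfl fun i _ => (Y.rowLen_eq_card).symm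

theorem two_mul_sum_betaSet (Y : YoungDiagram) :
    2 * (∑ h ∈ Y.betaSet, (h : ℤ)) + Y.betaSet.card - (Y.betaSet.card : ℤ) ^ 2 = 2 * Y.card := by
  have h1 : ∑ h ∈ Y.betaSet, h = Y.card + ∑ i ∈ range (Y.colLen 0), i := by
    rw [betaSet, sum_image Y.beta_injOn, ← sum_range_reflect (fun i => i), card_eq_sum_rowLen,
      ← sum_add_distrib]
    rfl
  have h2 : ∀ n : ℕ, 2 * ∑ i ∈ range n, (i : ℤ) = n ^ 2 - n := by
    intro n
    induction n with
    | zero => simp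
    | succ n ih => rw [sum_range_succ, mul_add, ih]; push_cast; ring
  have h3 := h2 (Y.colLen 0)
  have h4 : ∑ h ∈ Y.betaSet, (h : ℤ) = Y.card + ∑ i ∈ range (Y.colLen 0), (i : ℤ) := by
    have := congrArg (Nat.cast : ℕ → ℤ) h1
    push_cast at this
    exact this
  rw [card_betaSet, h4]
  linarith

theorem IsCore.sub_mem_betaSet {Y : YoungDiagram} {t h : ℕ} (hY : Y.IsCore t)
    (hh : h ∈ Y.betaSet) (ht : 0 < t) (hth : t ≤ h) : h - t ∈ Y.betaSet := by
  by_contra hy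
  simp only [betaSet, mem_image, mem_range, not_exists, not_and] at hh hy
  obtain ⟨i, hi, rfl⟩ := hh
  obtain ⟨y, hyt⟩ : ∃ y, Y.beta i = y + t := ⟨Y.beta i - t, by omega⟩
  rw [hyt, Nat.add_sub_cancel] at hy
  have hzero : Y.rowLen (Y.colLen 0) = 0 := by
    have := (Y.rowLen_pos_iff (Y.colLen 0)).not.2 (lt_irrefl _)
    omega
  have hex : ∃ l, Y.rowLen l + Y.colLen 0 ≤ y + l + 1 := ⟨Y.colLen 0, by omega⟩
  obtain ⟨l, hl, hmin⟩ : ∃ l, Y.rowLen l + Y.colLen 0 ≤ y + l + 1 ∧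
      ∀ l' < l, ¬ Y.rowLen l' + Y.colLen 0 ≤ y + l' + 1 := by
    classical
    exact ⟨Nat.find hex, Nat.find_spec hex, fun _ h => Nat.find_min hex h⟩
  have hlm : l ≤ Y.colLen 0 := by
    by_contra hlt
    exact hmin _ (not_le.1 hlt) (by omega)
  have hil : i < l := by
    by_contra hli
    have := Y.rowLen_anti l i (not_lt.1 hli)
    simp only [beta] at hyt
    omega
  have hrow : Y.colLen 0 ≤ y + l ∧ Y.rowLen l ≤ y + l - Y.colLen 0 := by
    rcases hlm.lt_or_eq with h | h
    · have := hy l h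
      simp only [beta] at this
      omega
    · rw [h, hzero]
      omega
  have hprev := hmin (l - 1) (by omega)
  have hin : (l - 1, y + l - Y.colLen 0) ∈ Y := mem_iff_lt_rowLen.2 (by omega)
  have hout : (l, y + l - Y.colLen 0) ∉ Y := fun h => by
    have := mem_iff_lt_rowLen.1 h
    omega
  have hcell : (i, y + l - Y.colLen 0) ∈ Y := Y.up_left_mem (by omega) le_rfl hin
  have hc1 := mem_iff_lt_colLen.1 hin
  have hc2 := mem_iff_lt_colLen.not.1 hout
  have hc3 := mem_iff_lt_rowLen.1 hcell
  refine hY _ hcell ?_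
  simp only [hookLength, beta] at hyt ⊢
  omega

end YoungDiagram

/-! ### The quadratic optimisation problem -/

/-- Summed form of `0 ≤ (d r - d s) * (L - (d r - d s))` over all `r < s < n`. -/
theorem sum_pair_nonneg (L : ℤ) (d : ℕ → ℤ) (n : ℕ)
    (hd : ∀ r s, r ≤ s → s < n → 0 ≤ d r - d s ∧ d r - d s ≤ L) :
    0 ≤ L * ((n - 1) * ∑ r ∈ range n, d r - 2 * ∑ r ∈ range n, r * d r)
      - n * ∑ r ∈ range n, d r ^ 2 + (∑ r ∈ range n, d r) ^ 2 := by
  induction n with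
  | zero => simp
  | succ n ih =>
    have ih := ih fun r s hrs hs => hd r s hrs (by omega)
    have h1 : 0 ≤ ∑ r ∈ range n, (d r - d n) * (L - (d r - d n)) := by
      refine sum_nonneg fun r hr => ?_
      have := hd r n (mem_range.1 hr).le (by omega)
      exact mul_nonneg this.1 (by linarith)
    have h2 : ∑ r ∈ range n, (d r - d n) * (L - (d r - d n))
        = (L + 2 * d n) * ∑ r ∈ range n, d r - ∑ r ∈ range n, d r ^ 2
          - n * (d n * (L + d n)) := by
      have : ∀ r ∈ range n, (d r - d n) * (L - (d r - d n))
          = (L + 2 * d n) * d r - d r ^ 2 - d n * (L + d n) := fun r _ => by ring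
      rw [sum_congr rfl this, sum_sub_distrib, sum_sub_distrib, ← mul_sum]
      simp
    simp only [sum_range_succ]
    push_cast
    linarith

theorem sum_quadratic_expand (A B : ℤ) (d : ℕ → ℤ) (n : ℕ) :
    3 * ∑ r ∈ range n, (2 * (r + 1) * B * (A - 2 * r + d r) - (A - 2 * r + d r) ^ 2)
      = 6 * B * n * A + 3 * B * (A - 2) * (n * (n - 1)) - 2 * B * ((n - 1) * n * (2 * n - 1))
        - 3 * n * A ^ 2 + 6 * A * (n * (n - 1)) - 2 * ((n - 1) * n * (2 * n - 1))
        + 6 * (B - A) * ∑ r ∈ range n, d r + (6 * B + 12) * ∑ r ∈ range n, r * d r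
        - 3 * ∑ r ∈ range n, d r ^ 2 := by
  induction n with
  | zero => simp
  | succ n ih =>
    simp only [sum_range_succ]
    rw [mul_add, ih]
    push_cast
    ring

theorem sum_affine_add (A : ℤ) (d : ℕ → ℤ) (n : ℕ) :
    ∑ r ∈ range n, (A - 2 * r + d r) = n * A - n * (n - 1) + ∑ r ∈ range n, d r := by
  induction n with
  | zero => simp
  | succ n ih =>
    simp only [sum_range_succ]
    rw [ih]
    push_cast
    ring

theorem quadratic_bound (k m : ℕ) (a : ℕ → ℤ) (hstep : ∀ r, r + 1 < m → a (r + 1) + 2 ≤ a r)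
    (hpos : ∀ r < m, 1 ≤ a r) (hub : ∀ r < m, a r ≤ 2 * k - 2 - 2 * r) :
    3 * (∑ r ∈ range m, (2 * (r + 1) * (2 * k - 1) * a r - a r ^ 2) - (∑ r ∈ range m, a r) ^ 2)
      ≤ (k : ℤ) ^ 2 * (k ^ 2 - 1) := by
  obtain ⟨d, hd⟩ : ∃ d : ℕ → ℤ, ∀ r, a r = (m - 2 + k) - 2 * r + d r :=
    ⟨fun r => a r - ((m - 2 + k) - 2 * r), fun r => by ring⟩
  have hanti : ∀ r s, r ≤ s → s < m → d s ≤ d r := by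
    intro r s hrs
    induction s, hrs using Nat.le_induction with
    | base => intro _; exact le_rfl
    | succ s _ ih =>
      intro hs
      have h1 := ih (by omega)
      have h2 := hstep s hs
      rw [hd, hd] at h2
      push_cast at h2
      linarith
  have hpair := sum_pair_nonneg (2 * k + 1) d m fun r s hrs hs => by
    have h1 := hanti r s hrs hs
    have h2 := hpos s hs
    have h3 := hub r (by omega)
    have h4 : (r : ℤ) ≤ s := by exact_mod_cast hrs
    rw [hd] at h2 h3
    constructor <;> linarith
  have sq_sub_nonneg_int : ∀ x : ℤ, 0 ≤ x ^ 2 - x := fun x => by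
    rcases le_or_gt x 0 with h | h <;> nlinarith
  have hsq : 0 ≤ ∑ r ∈ range m, d r ^ 2 - ∑ r ∈ range m, d r := by
    rw [← sum_sub_distrib]
    exact sum_nonneg fun r _ => sq_sub_nonneg_int _
  have hsq' : 0 ≤ ((m : ℤ) + 1) * (∑ r ∈ range m, d r ^ 2 - ∑ r ∈ range m, d r) :=
    mul_nonneg (by positivity) hsq
  have hconst : 0 ≤ (k : ℤ) * (2 * m + k + 1) * (((k : ℤ) - m) ^ 2 - (k - m)) :=
    mul_nonneg (by positivity) (sq_sub_nonneg_int _)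
  have hexp := sum_quadratic_expand (m - 2 + k) (2 * k - 1) d m
  have hlin := sum_affine_add (m - 2 + k) d m
  simp only [hd]
  rw [hlin, mul_sub, hexp]
  nlinarith [hpair, hsq', hconst]

/-! ### Bounding a set closed under the subtractions -/

theorem two_mul_sum_add_card_le (A : Finset ℕ) (M : ℕ) (hA : ∀ x ∈ A, x < M) :
    2 * ∑ x ∈ A, x + A.card ^ 2 + A.card ≤ 2 * A.card * M := by
  induction A using Finset.induction_on_max generalizing M with
  | empty => simp
  | insert x A hx ih =>
    have hxA : x ∉ A := fun h => lt_irrefl _ (hx x h)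
    have h1 := ih x hx
    have h2 : x + 1 ≤ M := hA x (mem_insert_self _ _)
    rw [sum_insert hxA, card_insert_of_notMem hxA]
    nlinarith [Nat.mul_le_mul_left (2 * (A.card + 1)) h2]

section SubtractionClosed

variable {k : ℕ} {H : Finset ℕ}

theorem notMem_of_mem_Icc (hk : 1 ≤ k) (h0 : 0 ∉ H)
    (hc : ∀ h ∈ H, ∀ t, 2 * k - 1 ≤ t → t ≤ 2 * k + 1 → t ≤ h → h - t ∈ H) (r h : ℕ)
    (h1 : r * (2 * k - 1) ≤ h) (h2 : h ≤ r * (2 * k + 1)) : h ∉ H := by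
  induction r generalizing h with
  | zero =>
    have : h = 0 := by omega
    rwa [this]
  | succ r ih =>
    intro hh
    rw [add_mul, one_mul] at h1 h2
    have hle : r * (2 * k - 1) ≤ r * (2 * k + 1) := Nat.mul_le_mul_left _ (by omega)
    by_cases c1 : h ≤ r * (2 * k + 1) + (2 * k - 1)
    · exact ih (h - (2 * k - 1)) (by omega) (by omega)
        (hc h hh _ (by omega) (by omega) (by omega))
    by_cases c2 : h ≤ r * (2 * k + 1) + 2 * k
    · exact ih (h - 2 * k) (by omega) (by omega) (hc h hh _ (by omega) (by omega) (by omega))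
    · exact ih (h - (2 * k + 1)) (by omega) (by omega)
        (hc h hh _ (by omega) (by omega) (by omega))

theorem mem_Ioo_of_div_eq (hk : 1 ≤ k) (h0 : 0 ∉ H)
    (hc : ∀ h ∈ H, ∀ t, 2 * k - 1 ≤ t → t ≤ 2 * k + 1 → t ≤ h → h - t ∈ H) {r h : ℕ}
    (hh : h ∈ H) (hr : h / (2 * k + 1) = r) :
    r * (2 * k + 1) < h ∧ h < (r + 1) * (2 * k - 1) := by
  have h1 : r * (2 * k + 1) ≤ h := by rw [← hr]; exact Nat.div_mul_le_self _ _
  have h2 : h < (r + 1) * (2 * k + 1) := by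
    rw [← Nat.div_lt_iff_lt_mul (by omega)]
    omega
  have hle : r * (2 * k - 1) ≤ r * (2 * k + 1) := Nat.mul_le_mul_left _ (by omega)
  constructor
  · by_contra hcon
    exact notMem_of_mem_Icc hk h0 hc r h (by omega) (by omega) hh
  · by_contra hcon
    exact notMem_of_mem_Icc hk h0 hc (r + 1) h (by omega) (by omega) hh

theorem card_filter_div_succ_add_two_le (hk : 1 ≤ k) (h0 : 0 ∉ H)
    (hc : ∀ h ∈ H, ∀ t, 2 * k - 1 ≤ t → t ≤ 2 * k + 1 → t ≤ h → h - t ∈ H) (r : ℕ)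
    (hne : (H.filter fun h => h / (2 * k + 1) = r + 1).Nonempty) :
    (H.filter fun h => h / (2 * k + 1) = r + 1).card + 2
      ≤ (H.filter fun h => h / (2 * k + 1) = r).card := by
  set A := H.filter fun h => h / (2 * k + 1) = r + 1 with hA
  have hbd : ∀ h ∈ A, h ∈ H ∧ r * (2 * k + 1) + (2 * k + 1) < h ∧
      h < r * (2 * k - 1) + 2 * (2 * k - 1) := by
    intro h hh
    rw [hA, mem_filter] at hh
    have := mem_Ioo_of_div_eq hk h0 hc hh.1 hh.2
    rw [add_mul, one_mul, add_mul, add_mul, one_mul] at this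
    exact ⟨hh.1, this.1, by omega⟩
  have hle : r * (2 * k - 1) + 2 * r = r * (2 * k + 1) := by
    rw [mul_comm 2 r, ← mul_add]
    congr 1
    omega
  have hmem : ∀ h ∈ A, ∀ t, 2 * k - 1 ≤ t → t ≤ 2 * k + 1 →
      h - t ∈ H.filter fun h => h / (2 * k + 1) = r := by
    intro h hh t ht1 ht2
    obtain ⟨hH, hb1, hb2⟩ := hbd h hh
    rw [mem_filter]
    refine ⟨hc h hH t ht1 ht2 (by omega), ?_⟩
    rw [Nat.div_eq_iff (by omega)]
    constructor <;> omega
  set M := A.max' hne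
  have hM : M ∈ A := A.max'_mem hne
  have hMH := hbd M hM
  set B := A.image fun h => h - (2 * k + 1) with hB
  have hBcard : B.card = A.card := card_image_of_injOn fun x hx y hy hxy => by
    have := hbd x hx
    have := hbd y hy
    omega
  have hBle : ∀ b ∈ B, b + (2 * k + 1) ≤ M := by
    intro b hb
    obtain ⟨h, hh, rfl⟩ := mem_image.1 hb
    have := A.le_max' h hh
    have := hbd h hh
    omega
  have hn1 : M - 2 * k ∉ B := fun h => by have := hBle _ h; omega
  have hn2 : M - (2 * k - 1) ∉ insert (M - 2 * k) B := by
    rw [mem_insert, not_or]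
    exact ⟨by omega, fun h => by have := hBle _ h; omega⟩
  rw [← hBcard, show B.card + 2 = (insert (M - (2 * k - 1)) (insert (M - 2 * k) B)).card by
    rw [card_insert_of_notMem hn2, card_insert_of_notMem hn1]]
  refine card_le_card fun x hx => ?_
  rw [mem_insert, mem_insert] at hx
  rcases hx with rfl | rfl | hx
  · exact hmem M hM _ (by omega) (by omega)
  · exact hmem M hM _ (by omega) (by omega)
  · obtain ⟨h, hh, rfl⟩ := mem_image.1 hx
    exact hmem h hh _ (by omega) (by omega)

theorem card_filter_div_le (hk : 1 ≤ k) (h0 : 0 ∉ H)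
    (hc : ∀ h ∈ H, ∀ t, 2 * k - 1 ≤ t → t ≤ 2 * k + 1 → t ≤ h → h - t ∈ H) (r : ℕ)
    (hne : (H.filter fun h => h / (2 * k + 1) = r).Nonempty) :
    (H.filter fun h => h / (2 * k + 1) = r).card + 2 + 2 * r ≤ 2 * k := by
  have hsub : (H.filter fun h => h / (2 * k + 1) = r)
      ⊆ Ioo (r * (2 * k + 1)) ((r + 1) * (2 * k - 1)) := by
    intro h hh
    rw [mem_filter] at hh
    exact mem_Ioo.2 (mem_Ioo_of_div_eq hk h0 hc hh.1 hh.2)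
  obtain ⟨h, hh⟩ := hne
  have h1 := mem_Ioo.1 (hsub hh)
  have h2 := card_le_card hsub
  have hle : r * (2 * k - 1) + 2 * r = r * (2 * k + 1) := by
    rw [mul_comm 2 r, ← mul_add]
    congr 1
    omega
  rw [Nat.card_Ioo] at h2
  rw [add_mul, one_mul] at h1 h2
  omega

theorem sum_sub_choose_card_le (hk : 1 ≤ k) (h0 : 0 ∉ H)
    (hc : ∀ h ∈ H, ∀ t, 2 * k - 1 ≤ t → t ≤ 2 * k + 1 → t ≤ h → h - t ∈ H) :
    3 * (2 * (∑ h ∈ H, (h : ℤ)) + H.card - (H.card : ℤ) ^ 2) ≤ (k : ℤ) ^ 2 * (k ^ 2 - 1) := by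
  classical
  set A : ℕ → Finset ℕ := fun r => H.filter fun h => h / (2 * k + 1) = r with hA
  have hex : ∃ r, ¬ (A r).Nonempty := by
    refine ⟨k, fun h => ?_⟩
    have := card_filter_div_le hk h0 hc k h
    omega
  obtain ⟨m, hm, hmin⟩ : ∃ m, ¬ (A m).Nonempty ∧ ∀ r < m, (A r).Nonempty :=
    ⟨Nat.find hex, Nat.find_spec hex, fun _ h => not_not.1 (Nat.find_min hex h)⟩
  have hempty : ∀ r, m ≤ r → ¬ (A r).Nonempty := by
    intro r hr
    induction r, hr using Nat.le_induction with
    | base => exact hm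
    | succ r _ ih =>
      intro h
      have := card_filter_div_succ_add_two_le hk h0 hc r h
      exact ih (card_pos.1 (by simp only [hA]; omega))
  have hmaps : ∀ h ∈ H, h / (2 * k + 1) ∈ range m := by
    intro h hh
    rw [mem_range]
    by_contra hcon
    exact hempty _ (not_lt.1 hcon) ⟨h, mem_filter.2 ⟨hh, rfl⟩⟩
  have hcard : (H.card : ℤ) = ∑ r ∈ range m, ((A r).card : ℤ) := by
    exact_mod_cast card_eq_sum_card_fiberwise hmaps
  have hsum : ∑ h ∈ H, (h : ℤ) = ∑ r ∈ range m, ∑ h ∈ A r, (h : ℤ) :=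
    (sum_fiberwise_of_maps_to hmaps _).symm
  have hrow : ∀ r ∈ range m, 2 * ∑ h ∈ A r, (h : ℤ) + (A r).card
      ≤ 2 * (r + 1) * (2 * k - 1) * ((A r).card : ℤ) - ((A r).card : ℤ) ^ 2 := by
    intro r _
    have h1 := two_mul_sum_add_card_le (A r) ((r + 1) * (2 * k - 1)) fun h hh => by
      rw [mem_filter] at hh
      exact (mem_Ioo_of_div_eq hk h0 hc hh.1 hh.2).2
    zify [show 1 ≤ 2 * k by omega] at h1
    linarith
  have htot := sum_le_sum hrow
  rw [sum_add_distrib, ← mul_sum, ← hsum, ← hcard] at htot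
  have hquad := quadratic_bound k m (fun r => ((A r).card : ℤ))
    (fun r hr => by exact_mod_cast card_filter_div_succ_add_two_le hk h0 hc r (hmin _ hr))
    (fun r hr => by exact_mod_cast card_pos.2 (hmin r hr))
    (fun r hr => by
      have := card_filter_div_le hk h0 hc r (hmin r hr)
      have : ((A r).card : ℤ) + 2 + 2 * r ≤ 2 * k := by exact_mod_cast this
      linarith)
  rw [← hcard] at hquad
  linarith

end SubtractionClosed

theorem six_mul_sum_triangular (k : ℕ) :
    6 * ((∑ j ∈ range k, j * (j + 1) / 2 : ℕ) : ℤ) = (k - 1) * k * (k + 1) := by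
  induction k with
  | zero => simp
  | succ n ih =>
    have h : 2 * ((n * (n + 1) / 2 : ℕ) : ℤ) = n * (n + 1) := by
      exact_mod_cast Nat.mul_div_cancel' (Nat.even_mul_succ_self n).two_dvd
    rw [sum_range_succ, Nat.cast_add, mul_add, ih]
    push_cast at h ⊢
    linarith

/-! ### The extremal partition -/

/-- The partition with `2 * r + 1` columns of length `(k - 1 - r) * (k - r)` for each `r < k`. -/
def extremalDiagram (k : ℕ) : YoungDiagram where
  cells := (range (k * k) ×ˢ range (k * k)).filter
    fun c => c.1 < (k - 1 - c.2.sqrt) * (k - c.2.sqrt)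
  isLowerSet := by
    rintro ⟨i, j⟩ ⟨i', j'⟩ ⟨hi, hj⟩ h
    simp only [coe_filter, mem_product, mem_range, Set.mem_ofPred_eq] at hi hj h ⊢
    have hs : j'.sqrt ≤ j.sqrt := Nat.sqrt_le_sqrt hj
    have hle : (k - 1 - j.sqrt) * (k - j.sqrt) ≤ (k - 1 - j'.sqrt) * (k - j'.sqrt) :=
      Nat.mul_le_mul (by omega) (by omega)
    omega

theorem mem_extremalDiagram {k i j : ℕ} :
    (i, j) ∈ extremalDiagram k ↔ i < (k - 1 - j.sqrt) * (k - j.sqrt) := by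
  rw [← YoungDiagram.mem_cells]
  simp only [extremalDiagram, mem_filter, mem_product, mem_range, and_iff_right_iff_imp]
  intro h
  have hpos : 0 < k - j.sqrt := by
    rcases Nat.eq_zero_or_pos (k - j.sqrt) with h0 | h0
    · rw [h0, mul_zero] at h
      omega
    · exact h0
  have hle : (k - 1 - j.sqrt) * (k - j.sqrt) ≤ k * k := Nat.mul_le_mul (by omega) (by omega)
  exact ⟨by omega, Nat.sqrt_lt.1 (by omega)⟩

theorem colLen_extremalDiagram (k j : ℕ) :
    (extremalDiagram k).colLen j = (k - 1 - j.sqrt) * (k - j.sqrt) := by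
  refine eq_of_forall_lt_iff fun i => ?_
  rw [← YoungDiagram.mem_iff_lt_colLen, mem_extremalDiagram]

theorem rowLen_extremalDiagram {k i v : ℕ} (h1 : v * (v + 1) ≤ i) (h2 : i < (v + 1) * (v + 2)) :
    (extremalDiagram k).rowLen i = (k - 1 - v) * (k - 1 - v) := by
  refine eq_of_forall_lt_iff fun j => ?_
  rw [← YoungDiagram.mem_iff_lt_rowLen, mem_extremalDiagram, ← Nat.sqrt_lt]
  constructor
  · intro h
    by_contra hcon
    have : (k - 1 - j.sqrt) * (k - j.sqrt) ≤ v * (v + 1) := Nat.mul_le_mul (by omega) (by omega)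
    omega
  · intro h
    have : (v + 1) * (v + 2) ≤ (k - 1 - j.sqrt) * (k - j.sqrt) :=
      Nat.mul_le_mul (by omega) (by omega)
    omega

theorem hookLength_extremalDiagram {k i j : ℕ} (h : (i, j) ∈ extremalDiagram k) :
    (extremalDiagram k).hookLength i j < 2 * k - 1 ∨
      2 * k + 1 < (extremalDiagram k).hookLength i j := by
  obtain ⟨v, hv1, hv2⟩ : ∃ v, v * (v + 1) ≤ i ∧ i < (v + 1) * (v + 2) := by
    have hex : ∃ v, i < (v + 1) * (v + 2) := ⟨i, by nlinarith⟩
    classical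
    refine ⟨Nat.find hex, ?_, Nat.find_spec hex⟩
    rcases hf : Nat.find hex with _ | u
    · omega
    · exact not_lt.1 (Nat.find_min hex (by omega : u < Nat.find hex))
  have hrow := mem_extremalDiagram.1 h
  have hj1 := Nat.sqrt_le j
  have hj2 := Nat.sqrt_le_add j
  have hj3 : j < (k - 1 - v) * (k - 1 - v) := by
    rw [← rowLen_extremalDiagram hv1 hv2]
    exact YoungDiagram.mem_iff_lt_rowLen.1 h
  have hjv := Nat.sqrt_lt.2 hj3
  rw [YoungDiagram.hookLength, rowLen_extremalDiagram hv1 hv2, colLen_extremalDiagram]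
  generalize j.sqrt = r at *
  obtain ⟨e, rfl⟩ : ∃ e, k = r + v + e + 2 := ⟨k - (r + v + 2), by omega⟩
  rw [show r + v + e + 2 - 1 - v = r + e + 1 by omega] at hj3 ⊢
  rw [show r + v + e + 2 - 1 - r = v + e + 1 by omega,
    show r + v + e + 2 - r = v + e + 2 by omega] at hrow ⊢
  have key : (r + e + 1) * (r + e + 1) + (v + e + 1) * (v + e + 2)
      = r * r + v * (v + 1) + (2 * r + 2 * v + 2 * e + 3) * (e + 1) := by ring
  have hv3 : i ≤ v * (v + 1) + 2 * v + 1 := by nlinarith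
  rcases Nat.eq_zero_or_pos e with rfl | he
  · left
    omega
  · right
    have : (2 * r + 2 * v + 2 * e + 3) * 2 + 2 * (e - 1)
        ≤ (2 * r + 2 * v + 2 * e + 3) * (e + 1) := by
      obtain ⟨f, rfl⟩ : ∃ f, e = f + 1 := ⟨e - 1, by omega⟩
      rw [Nat.add_sub_cancel]
      nlinarith
    omega

theorem sum_range_sq_sqrt (f : ℕ → ℕ) (n : ℕ) :
    ∑ j ∈ range (n * n), f j.sqrt = ∑ r ∈ range n, (2 * r + 1) * f r := by
  induction n with
  | zero => simp
  | succ n ih =>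
    rw [show (n + 1) * (n + 1) = n * n + (2 * n + 1) by ring, sum_range_add, ih,
      sum_range_succ (fun r => (2 * r + 1) * f r)]
    have hsqrt : ∀ x ∈ range (2 * n + 1), f (n * n + x).sqrt = f n := fun x hx => by
      rw [Nat.sqrt_add_eq n (by have := mem_range.1 hx; omega)]
    rw [sum_congr rfl hsqrt, sum_const, card_range, smul_eq_mul]

theorem card_extremalDiagram (k : ℕ) :
    (extremalDiagram k).card = k * ∑ j ∈ range k, j * (j + 1) / 2 := by
  have hmaps : ∀ c ∈ (extremalDiagram k).cells, c.2 ∈ range (k * k) := by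
    intro c hc
    exact (mem_product.1 (mem_filter.1 hc).1).2
  have h1 : (extremalDiagram k).card
      = ∑ j ∈ range (k * k), (k - 1 - j.sqrt) * (k - j.sqrt) := by
    rw [YoungDiagram.card, card_eq_sum_card_fiberwise hmaps]
    refine sum_congr rfl fun j _ => ?_
    rw [← colLen_extremalDiagram, YoungDiagram.colLen_eq_card]
    rfl
  rw [h1, sum_range_sq_sqrt fun r => (k - 1 - r) * (k - r)]
  have h2 : ∀ (K : ℤ) (n : ℕ), 6 * ∑ r ∈ range n, (2 * (r : ℤ) + 1) * ((K - 1 - r) * (K - r))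
      = 6 * n ^ 2 * (K ^ 2 - K) - (2 * K - 1) * (2 * n * (n - 1) * (2 * n - 1) + 3 * n * (n - 1))
        + 3 * n ^ 2 * (n - 1) ^ 2 + n * (n - 1) * (2 * n - 1) := by
    intro K n
    induction n with
    | zero => simp
    | succ n ih =>
      rw [sum_range_succ, mul_add, ih]
      push_cast
      ring
  have h3 : ((∑ r ∈ range k, (2 * r + 1) * ((k - 1 - r) * (k - r)) : ℕ) : ℤ)
      = ∑ r ∈ range k, (2 * (r : ℤ) + 1) * (((k : ℤ) - 1 - r) * (k - r)) := by
    push_cast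
    refine sum_congr rfl fun r hr => ?_
    have hr := mem_range.1 hr
    rw [Nat.sub_sub, Nat.cast_sub (by omega), Nat.cast_sub (by omega)]
    push_cast
    ring
  have h4 := h2 k k
  have h5 := six_mul_sum_triangular k
  rw [← h3] at h4
  zify at h4 h5 ⊢
  have h6 := congrArg ((k : ℤ) * ·) h5
  linarith

theorem k_sum_triangular_eq_max (k : ℕ) (hk : 1 ≤ k) :
    IsGreatest {n : ℕ | ∃ Y : YoungDiagram,
        Y.IsCore (2 * k - 1) ∧ Y.IsCore (2 * k) ∧ Y.IsCore (2 * k + 1) ∧ Y.card = n}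
      (k * ∑ j ∈ Finset.range k, j * (j + 1) / 2) := by
  constructor
  · refine ⟨extremalDiagram k, ?_, ?_, ?_, card_extremalDiagram k⟩ <;>
    · rintro ⟨i, j⟩ hc
      have := hookLength_extremalDiagram ((YoungDiagram.mem_cells _).1 hc)
      dsimp only
      omega
  · rintro n ⟨Y, hY1, hY2, hY3, rfl⟩
    have hclosed : ∀ h ∈ Y.betaSet, ∀ t, 2 * k - 1 ≤ t → t ≤ 2 * k + 1 → t ≤ h →
        h - t ∈ Y.betaSet := by
      intro h hh t ht1 ht2 hth
      have hcore : Y.IsCore t := by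
        obtain rfl | rfl | rfl : t = 2 * k - 1 ∨ t = 2 * k ∨ t = 2 * k + 1 := by omega
        · exact hY1
        · exact hY2
        · exact hY3
      exact hcore.sub_mem_betaSet hh (by omega) hth
    have hbound := sum_sub_choose_card_le hk Y.zero_notMem_betaSet hclosed
    rw [Y.two_mul_sum_betaSet] at hbound
    have htri := congrArg ((k : ℤ) * ·) (six_mul_sum_triangular k)
    zify at htri ⊢
    linarith
end

section
/- For every integer k ≥ 1, the maximum of the sizes of all simultaneous (2k−1, 2k+1)-core partitions equals 2k · Σ_{j=0}^{k−1} 2·T_j, where T_j denotes the jth triangular number. -/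
open Finset in
theorem card_add_lt (q : ℕ) :
    2 * Nat.card {p : ℕ × ℕ // p.1 + p.2 < q} = q * (q + 1) := by
  have h1 : Nat.card {p : ℕ × ℕ // p.1 + p.2 < q} =
      #{p ∈ range q ×ˢ range q | p.1 + p.2 < q} := by
    refine Nat.subtype_card _ fun p => ?_
    simp only [mem_filter, mem_product, mem_range]
    omega
  have h2 : ∀ s ∈ range q,
      #{p ∈ {p ∈ range q ×ˢ range q | p.1 + p.2 < q} | p.1 + p.2 = s} = s + 1 := by
    intro s hs
    rw [← Nat.card_antidiagonal s]
    congr 1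
    ext p
    simp only [mem_filter, mem_product, mem_range, HasAntidiagonal.mem_antidiagonal] at hs ⊢
    omega
  rw [h1, card_eq_sum_card_fiberwise (f := fun p => p.1 + p.2) (t := range q), sum_congr rfl h2]
  · clear h1 h2
    induction q with
    | zero => rfl
    | succ q ih => rw [sum_range_succ, mul_add, ih]; ring
  · intro p hp
    simpa using (mem_filter.1 hp).2

/-- The number of pairs of a bead `u - a * (m + 1)` and a gap `v + a * n`, with `m n : ℕ`, such that
the bead lies above the gap, where `D = u - v`. -/
noncomputable def inversionCount (a : ℕ) (D : ℤ) : ℕ :=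
  Nat.card {p : ℕ × ℕ // (a : ℤ) * (p.1 + p.2 + 1) < D}

theorem finite_inversions {a : ℕ} (ha : 0 < a) (D : ℤ) :
    Finite {p : ℕ × ℕ // (a : ℤ) * (p.1 + p.2 + 1) < D} := by
  refine Set.Finite.subset (Finset.finite_toSet (Finset.range D.toNat ×ˢ Finset.range D.toNat)) ?_
  rintro ⟨m, n⟩ h
  have h' : (a : ℤ) * (m + n + 1) < D := h
  have : (m + n + 1 : ℤ) ≤ a * (m + n + 1) := le_mul_of_one_le_left (by positivity) (by omega)
  simp only [Finset.coe_product, Set.mem_prod, Finset.mem_coe, Finset.mem_range]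
  omega

theorem inversionCount_mono {a : ℕ} (ha : 0 < a) : Monotone (inversionCount a) := by
  intro D E h
  have := finite_inversions ha E
  exact Nat.card_le_card_of_injective
    (fun p : {p : ℕ × ℕ // (a : ℤ) * (p.1 + p.2 + 1) < D} => ⟨p.1, p.2.trans_le h⟩)
    fun p q hpq => Subtype.ext (congrArg (fun z => z.1) hpq)

theorem two_mul_inversionCount {a : ℕ} {D : ℤ} (q : ℕ) (h1 : a * q < D) (h2 : D ≤ a * (q + 1)) :
    2 * inversionCount a D = q * (q + 1) := by
  rw [← card_add_lt, inversionCount]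
  congr 1
  refine Nat.card_congr (Equiv.subtypeEquivRight fun p => ⟨fun h => ?_, fun h => ?_⟩)
  · have : (a : ℤ) * (p.1 + p.2 + 1) < a * (q + 1) := h.trans_le h2
    have := lt_of_mul_lt_mul_left this (by positivity)
    omega
  · have : (a : ℤ) * (p.1 + p.2 + 1) ≤ a * q :=
      mul_le_mul_of_nonneg_left (by omega) (by positivity)
    omega

theorem inversionCount_of_nonpos {a : ℕ} {D : ℤ} (hD : D ≤ 0) : inversionCount a D = 0 := by
  have : IsEmpty {p : ℕ × ℕ // (a : ℤ) * (p.1 + p.2 + 1) < D} := by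
    refine ⟨fun p => ?_⟩
    have := p.2
    have : (0 : ℤ) ≤ a * (p.1.1 + p.1.2 + 1) := by positivity
    omega
  exact Nat.card_of_isEmpty

/-- Two injective enumerations of the same set differ by a bijection of the index types. -/
theorem exists_equiv_of_range_eq {α β γ : Type*} {f : α → γ} {g : β → γ}
    (hf : Function.Injective f) (hg : Function.Injective g) (h : Set.range f = Set.range g) :
    ∃ e : α ≃ β, ∀ x, g (e x) = f x := by
  refine ⟨(Equiv.ofInjective f hf).trans
    ((Equiv.setCongr h).trans (Equiv.ofInjective g hg).symm), fun x => ?_⟩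
  simp [Equiv.apply_ofInjective_symm]

namespace YoungDiagram

theorem card_eq_sum_inversionCount (Y : YoungDiagram) {a : ℕ} (ha : 0 < a) {β σ : ℕ → ℤ}
    (hβ : Function.Injective β) (hσ : Function.Injective σ)
    (hY : ∀ i j, (i, j) ∈ Y ↔ σ j < β i) {x : Fin a → ℤ}
    (hx : ∀ i j, (a : ℤ) ∣ x i - x j → i = j)
    (hβx : ∀ z, z ∈ Set.range β ↔ ∃ i, ∃ m : ℕ, z = x i - a * (m + 1))
    (hσx : ∀ z, z ∈ Set.range σ ↔ ∃ i, ∃ m : ℕ, z = x i + a * m) :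
    Y.card = ∑ i, ∑ j, inversionCount a (x i - x j) := by
  obtain ⟨e, he⟩ := exists_equiv_of_range_eq
    (f := fun p : Fin a × ℕ => x p.1 - a * (p.2 + 1)) (g := β)
    (by
      rintro ⟨i, m⟩ ⟨j, n⟩ h
      simp only at h
      obtain rfl : i = j := hx i j ⟨m - n, by linarith⟩
      have : (a : ℤ) * m = a * n := by linarith
      simpa [ha.ne'] using this) hβ
    (by ext z; rw [hβx]; simp [eq_comm])
  obtain ⟨e', he'⟩ := exists_equiv_of_range_eq
    (f := fun p : Fin a × ℕ => x p.1 + a * p.2) (g := σ)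
    (by
      rintro ⟨i, m⟩ ⟨j, n⟩ h
      simp only at h
      obtain rfl : i = j := hx i j ⟨n - m, by linarith⟩
      have : (a : ℤ) * m = a * n := by linarith
      simpa [ha.ne'] using this) hσ
    (by ext z; rw [hσx]; simp [eq_comm])
  have E : {c : ℕ × ℕ // c ∈ Y} ≃
      Σ i : Fin a, Σ j : Fin a, {p : ℕ × ℕ // (a : ℤ) * (p.1 + p.2 + 1) < x i - x j} :=
    calc {c : ℕ × ℕ // c ∈ Y}
      _ ≃ {c : (Fin a × ℕ) × (Fin a × ℕ) //
          (a : ℤ) * (c.1.2 + c.2.2 + 1) < x c.1.1 - x c.2.1} :=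
        (Equiv.subtypeEquiv (Equiv.prodCongr e e') (by
          rintro ⟨⟨i, m⟩, ⟨j, n⟩⟩
          simp only [Equiv.prodCongr_apply, Prod.map, hY, he, he']
          constructor <;> intro h <;> linarith)).symm
      _ ≃ _ :=
        { toFun := fun c => ⟨c.1.1.1, c.1.2.1, ⟨(c.1.1.2, c.1.2.2), c.2⟩⟩
          invFun := fun s => ⟨((s.1, s.2.2.1.1), (s.2.1, s.2.2.1.2)), s.2.2.2⟩
          left_inv := fun _ => rfl
          right_inv := fun _ => rfl }
  have hfin := finite_inversions ha
  have h1 : Y.card = Nat.card {c : ℕ × ℕ // c ∈ Y} :=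
    (Nat.subtype_card Y.cells fun _ => Iff.rfl).symm
  rw [h1, Nat.card_congr E, Nat.card_sigma]
  simp only [Nat.card_sigma, inversionCount]

/-- The position of the bead of row `i`. -/
def bead (Y : YoungDiagram) (i : ℕ) : ℤ := Y.rowLen i - i - 1

/-- The position of the gap of column `j`. -/
def gap (Y : YoungDiagram) (j : ℕ) : ℤ := j - Y.colLen j

variable (Y : YoungDiagram)

theorem mem_iff_gap_lt_bead (i j : ℕ) : (i, j) ∈ Y ↔ Y.gap j < Y.bead i := by
  have h1 := Y.mem_iff_lt_rowLen (i := i) (j := j)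
  have h2 := Y.mem_iff_lt_colLen (i := i) (j := j)
  unfold gap bead
  by_cases h : (i, j) ∈ Y
  · simp only [h, true_iff] at h1 h2 ⊢
    omega
  · simp only [h, false_iff] at h1 h2 ⊢
    omega

theorem gap_ne_bead (i j : ℕ) : Y.gap j ≠ Y.bead i := by
  have h1 := Y.mem_iff_lt_rowLen (i := i) (j := j)
  have h2 := Y.mem_iff_lt_colLen (i := i) (j := j)
  unfold gap bead
  by_cases h : (i, j) ∈ Y
  · simp only [h, true_iff] at h1 h2 ⊢
    omega
  · simp only [h, false_iff] at h1 h2 ⊢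
    omega

theorem bead_strictAnti : StrictAnti Y.bead := by
  intro i j h
  have := Y.rowLen_anti i j h.le
  unfold bead
  omega

theorem gap_strictMono : StrictMono Y.gap := by
  intro i j h
  have := Y.colLen_anti i j h.le
  unfold gap
  omega

theorem mem_range_gap_of_rowLen_zero_le {z : ℤ} (hz : (Y.rowLen 0 : ℤ) ≤ z) :
    z ∈ Set.range Y.gap := by
  refine ⟨z.toNat, ?_⟩
  have h1 := Y.mem_iff_lt_rowLen (i := 0) (j := z.toNat)
  have h2 := Y.mem_iff_lt_colLen (i := 0) (j := z.toNat)
  rw [h1] at h2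
  unfold gap
  omega

theorem mem_range_gap_or_bead (z : ℤ) : z ∈ Set.range Y.gap ∨ z ∈ Set.range Y.bead := by
  classical
  have hex : ∃ i, Y.bead i < z := by
    refine ⟨(Y.rowLen 0 - z).toNat, ?_⟩
    have := Y.rowLen_anti 0 (Y.rowLen 0 - z).toNat (Nat.zero_le _)
    unfold bead
    omega
  have hi := Nat.find_spec hex
  have hmin := fun m => Nat.find_min (m := m) hex
  rcases hfi : Nat.find hex with _ | i
  · rw [hfi] at hi
    left
    apply Y.mem_range_gap_of_rowLen_zero_le
    simp only [bead] at hi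
    omega
  · rw [hfi] at hi hmin
    have h1 := hmin i (Nat.lt_succ_self i)
    by_cases hz : Y.bead i = z
    · exact Or.inr ⟨i, hz⟩
    left
    simp only [bead] at hi h1 hz
    push_cast at hi
    refine ⟨(z + i + 1).toNat, ?_⟩
    have e1 := Y.mem_iff_lt_rowLen (i := i) (j := (z + i + 1).toNat)
    have e2 := Y.mem_iff_lt_colLen (i := i) (j := (z + i + 1).toNat)
    have e3 := Y.mem_iff_lt_rowLen (i := i + 1) (j := (z + i + 1).toNat)
    have e4 := Y.mem_iff_lt_colLen (i := i + 1) (j := (z + i + 1).toNat)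
    rw [e1] at e2
    rw [e3] at e4
    unfold gap
    omega

theorem mem_range_bead_iff (z : ℤ) : z ∈ Set.range Y.bead ↔ z ∉ Set.range Y.gap := by
  refine ⟨?_, fun h => (Y.mem_range_gap_or_bead z).resolve_left h⟩
  rintro ⟨i, rfl⟩ ⟨j, h⟩
  exact Y.gap_ne_bead i j h

variable {Y}

theorem IsCore.add_mem_range_gap {t : ℕ} (ht : 0 < t) (h : Y.IsCore t) {z : ℤ}
    (hz : z ∈ Set.range Y.gap) : z + t ∈ Set.range Y.gap := by
  by_contra hn
  obtain ⟨i, hi⟩ := (Y.mem_range_bead_iff _).2 hn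
  obtain ⟨j, rfl⟩ := hz
  have hm : (i, j) ∈ Y := (Y.mem_iff_gap_lt_bead i j).2 (by omega)
  have h1 := Y.mem_iff_lt_rowLen.1 hm
  have h2 := Y.mem_iff_lt_colLen.1 hm
  apply h (i, j) hm
  simp only [hookLength]
  simp only [bead, gap] at hi
  omega

theorem IsCore.exists_first_gaps {a : ℕ} (ha : 0 < a) (h : Y.IsCore a) :
    ∃ x : Fin a → ℤ, (∀ i j, (a : ℤ) ∣ x i - x j → i = j) ∧
      (∀ z, z ∈ Set.range Y.bead ↔ ∃ i, ∃ m : ℕ, z = x i - a * (m + 1)) ∧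
      (∀ z, z ∈ Set.range Y.gap ↔ ∃ i, ∃ m : ℕ, z = x i + a * m) := by
  have ha' : (0 : ℤ) < a := by omega
  have hex (r : Fin a) : ∃ x : ℤ, (x ∈ Set.range Y.gap ∧ (a : ℤ) ∣ x - r) ∧
      ∀ z : ℤ, (z ∈ Set.range Y.gap ∧ (a : ℤ) ∣ z - r) → x ≤ z := by
    apply Int.exists_least_of_bdd (P := fun x => x ∈ Set.range Y.gap ∧ (a : ℤ) ∣ x - r)
    · refine ⟨-Y.colLen 0, ?_⟩
      rintro z ⟨⟨j, rfl⟩, -⟩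
      have := Y.colLen_anti 0 j (Nat.zero_le _)
      unfold gap
      omega
    · refine ⟨r + a * Y.rowLen 0, Y.mem_range_gap_of_rowLen_zero_le ?_, ⟨Y.rowLen 0, by ring⟩⟩
      have : (Y.rowLen 0 : ℤ) ≤ a * Y.rowLen 0 := le_mul_of_one_le_left (by positivity) (by omega)
      omega
  choose x hx hmin using hex
  have hup (z : ℤ) (hz : z ∈ Set.range Y.gap) (m : ℕ) : z + a * m ∈ Set.range Y.gap := by
    induction m with
    | zero => simpa using hz
    | succ m ih =>
      have := h.add_mem_range_gap ha ih
      push_cast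
      rwa [mul_add, mul_one, ← add_assoc]
  have hres (z : ℤ) : ∃ i : Fin a, ∃ c : ℤ, z = x i + a * c := by
    have h0 := Int.emod_nonneg z ha'.ne'
    have h1 := Int.emod_lt_of_pos z ha'
    refine ⟨⟨(z % a).toNat, by omega⟩, ?_⟩
    obtain ⟨c, hc⟩ := (hx ⟨(z % a).toNat, by omega⟩).2
    refine ⟨z / a - c, ?_⟩
    have := Int.emod_add_mul_ediv z a
    simp only [Int.toNat_of_nonneg h0] at hc
    linarith
  have hgap (z : ℤ) : z ∈ Set.range Y.gap ↔ ∃ i, ∃ m : ℕ, z = x i + a * m := by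
    constructor
    · intro hz
      obtain ⟨i, c, rfl⟩ := hres z
      obtain ⟨d, hd⟩ := (hx i).2
      have := hmin i _ ⟨hz, ⟨d + c, by linarith⟩⟩
      have : 0 ≤ c := nonneg_of_mul_nonneg_right (by linarith) ha'
      exact ⟨i, c.toNat, by rw [Int.toNat_of_nonneg this]⟩
    · rintro ⟨i, m, rfl⟩
      exact hup _ (hx i).1 m
  refine ⟨x, fun i j hij => ?_, fun z => ?_, hgap⟩
  · have : (a : ℤ) ∣ (i : ℤ) - j := by
      have := (hij.sub (hx i).2).add (hx j).2
      ring_nf at this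
      obtain ⟨c, hc⟩ := this
      exact ⟨c, by linarith⟩
    have := Int.eq_zero_of_abs_lt_dvd this (by rw [abs_lt]; omega)
    omega
  · rw [mem_range_bead_iff, hgap]
    constructor
    · intro hz
      obtain ⟨i, c, rfl⟩ := hres z
      have : c < 0 := by
        by_contra hc
        exact hz ⟨i, c.toNat, by rw [Int.toNat_of_nonneg (by omega)]⟩
      refine ⟨i, (-c - 1).toNat, ?_⟩
      rw [Int.toNat_of_nonneg (by omega)]
      ring
    · rintro ⟨i, m, rfl⟩ hz
      rw [← hgap] at hz
      obtain ⟨d, hd⟩ := (hx i).2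
      have := hmin i _ ⟨hz, ⟨d - (m + 1), by linarith⟩⟩
      have : (0 : ℤ) < a * (m + 1) := by positivity
      omega

end YoungDiagram

/-- If every value of a monotone tuple, shifted by `b`, dominates a value congruent to it
modulo `a`, then consecutive values differ by at most `b`. -/
theorem sub_le_mul_of_monotone {a b : ℕ} (hab : IsCoprime (a : ℤ) b) {y : Fin a → ℤ}
    (hy : Monotone y) (hinj : ∀ i j, (a : ℤ) ∣ y i - y j → i = j)
    (hb : ∀ i, ∃ j, y j ≤ y i + b ∧ (a : ℤ) ∣ y i + b - y j) {i j : Fin a} (hij : i ≤ j) :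
    y j - y i ≤ ((j : ℤ) - i) * b := by
  have step (n : ℕ) (hn : n + 1 < a) : y ⟨n + 1, hn⟩ ≤ y ⟨n, by omega⟩ + b := by
    by_contra! hlt
    set s : Fin a := ⟨n, by omega⟩
    have key (c : ℕ) : ∃ l ≤ s, (a : ℤ) ∣ y s + c * b - y l := by
      induction c with
      | zero => exact ⟨s, le_rfl, by simp⟩
      | succ c ih =>
        obtain ⟨l, hl, hd⟩ := ih
        obtain ⟨l', hl', hd'⟩ := hb l
        refine ⟨l', ?_, ?_⟩
        · by_contra! hc
          have h1 : y ⟨n + 1, hn⟩ ≤ y l' := hy (Fin.mk_le_of_le_val hc)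
          have h2 := hy hl
          omega
        · have e : y s + (c + 1 : ℕ) * b - y l' = y s + c * b - y l + (y l + b - y l') := by
            push_cast
            ring
          exact e ▸ hd.add hd'
    obtain ⟨u, v, huv⟩ := hab
    have ha' : (0 : ℤ) < a := by omega
    obtain ⟨w, hw0⟩ : ∃ w, w = (y ⟨n + 1, hn⟩ - y s) * v := ⟨_, rfl⟩
    obtain ⟨l, hl, hd⟩ := key (w % a).toNat
    rw [Int.toNat_of_nonneg (Int.emod_nonneg _ ha'.ne')] at hd
    have hd2 : (a : ℤ) ∣ y ⟨n + 1, hn⟩ - y l := by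
      obtain ⟨c, hc⟩ := hd
      have hw := Int.emod_add_mul_ediv w a
      refine ⟨c + (w / a) * b + (y ⟨n + 1, hn⟩ - y s) * u, ?_⟩
      have e1 : w % a = w - a * (w / a) := by linarith
      rw [e1] at hc
      have e2 : w * b = (y ⟨n + 1, hn⟩ - y s) * (1 - u * a) := by
        rw [hw0]; linear_combination (y ⟨n + 1, hn⟩ - y s) * huv
      linear_combination hc - e2
    have := hinj _ _ hd2
    rw [← this] at hl
    exact absurd (Fin.le_def.1 hl) (by simp [s])
  obtain ⟨i, hi⟩ := i
  obtain ⟨j, hj⟩ := j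
  obtain ⟨d, rfl⟩ := Nat.exists_eq_add_of_le (Fin.mk_le_mk.1 hij)
  clear hij
  induction d with
  | zero => simp
  | succ d ih =>
    have h1 := ih (by omega) step
    have h2 := step (i + d) hj
    simp only [← add_assoc] at h1 h2 ⊢
    push_cast at h1 h2 ⊢
    linarith

theorem YoungDiagram.card_le_of_isCore {Y : YoungDiagram} {a b : ℕ} (ha : 0 < a) (hb : 0 < b)
    (hab : IsCoprime (a : ℤ) b) (hYa : Y.IsCore a) (hYb : Y.IsCore b) :
    Y.card ≤ ∑ i : Fin a, ∑ j : Fin a, inversionCount a (((i : ℤ) - j) * b) := by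
  obtain ⟨x, hx, hbead, hgap⟩ := hYa.exists_first_gaps ha
  rw [Y.card_eq_sum_inversionCount ha Y.bead_strictAnti.injective Y.gap_strictMono.injective
    Y.mem_iff_gap_lt_bead hx hbead hgap]
  set τ := Tuple.sort x
  have hy : Monotone (x ∘ τ) := Tuple.monotone_sort x
  rw [← Equiv.sum_comp τ]
  refine Finset.sum_le_sum fun i _ => ?_
  rw [← Equiv.sum_comp τ]
  refine Finset.sum_le_sum fun j _ => ?_
  rcases le_total i j with hij | hij
  · have h : x (τ i) ≤ x (τ j) := hy hij
    rw [inversionCount_of_nonpos (sub_nonpos.2 h)]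
    exact Nat.zero_le _
  · refine inversionCount_mono ha (sub_le_mul_of_monotone (y := x ∘ τ) hab hy
      (fun i j h => τ.injective (hx _ _ h)) (fun i => ?_) hij)
    obtain ⟨l, m, hl⟩ := (hgap _).1
      (hYb.add_mem_range_gap hb ((hgap (x (τ i))).2 ⟨τ i, 0, by simp⟩))
    refine ⟨τ.symm l, ?_, ⟨m, ?_⟩⟩
    · have : (0 : ℤ) ≤ a * m := by positivity
      simp only [Function.comp_apply, Equiv.apply_symm_apply]
      omega
    · simp only [Function.comp_apply, Equiv.apply_symm_apply]
      omega

/-- If gaps and beads partition `ℤ`, the diagram they define has the expected hook lengths. -/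
theorem YoungDiagram.hookLength_eq {Y : YoungDiagram} {β σ : ℕ → ℤ} (hβ : StrictAnti β)
    (hσ : StrictMono σ) (hY : ∀ i j, (i, j) ∈ Y ↔ σ j < β i)
    (hc : ∀ z, z ∈ Set.range β ↔ z ∉ Set.range σ) {i j : ℕ} (hij : (i, j) ∈ Y) :
    (Y.hookLength i j : ℤ) = β i - σ j := by
  have h1 := Y.mem_iff_lt_rowLen.1 hij
  have h2 := Y.mem_iff_lt_colLen.1 hij
  have h3 := (hY i j).1 hij
  have key : Finset.Icc (σ j) (β i) =
      (Finset.Ico j (Y.rowLen i)).image σ ∪ (Finset.Ico i (Y.colLen j)).image β := by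
    ext z
    simp only [Finset.mem_Icc, Finset.mem_union, Finset.mem_image, Finset.mem_Ico,
      ← Y.mem_iff_lt_rowLen, ← Y.mem_iff_lt_colLen, hY]
    constructor
    · rintro ⟨hz1, hz2⟩
      by_cases hz : z ∈ Set.range σ
      · obtain ⟨l, rfl⟩ := hz
        have hne : σ l ≠ β i := fun h => (hc (β i)).1 ⟨i, rfl⟩ ⟨l, h⟩
        exact Or.inl ⟨l, ⟨hσ.le_iff_le.1 hz1, lt_of_le_of_ne hz2 hne⟩, rfl⟩
      · obtain ⟨l, rfl⟩ := (hc z).2 hz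
        have hne : σ j ≠ β l := fun h => hz ⟨j, h⟩
        exact Or.inr ⟨l, ⟨hβ.le_iff_ge.1 hz2, lt_of_le_of_ne hz1 hne⟩, rfl⟩
    · rintro (⟨l, ⟨hl1, hl2⟩, rfl⟩ | ⟨l, ⟨hl1, hl2⟩, rfl⟩)
      · exact ⟨hσ.monotone hl1, hl2.le⟩
      · exact ⟨hl2.le, hβ.antitone hl1⟩
  have hdisj : Disjoint ((Finset.Ico j (Y.rowLen i)).image σ)
      ((Finset.Ico i (Y.colLen j)).image β) := by
    rw [Finset.disjoint_left]
    intro z hz hz'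
    obtain ⟨l, -, rfl⟩ := Finset.mem_image.1 hz
    obtain ⟨m, -, hm⟩ := Finset.mem_image.1 hz'
    exact (hc _).1 ⟨m, hm⟩ ⟨l, rfl⟩
  have := congrArg Finset.card key
  rw [Finset.card_union_of_disjoint hdisj, Finset.card_image_of_injective _ hσ.injective,
    Finset.card_image_of_injective _ hβ.injective, Int.card_Icc, Nat.card_Ico, Nat.card_Ico] at this
  unfold YoungDiagram.hookLength
  omega

theorem YoungDiagram.exists_isCore_card_eq {a b : ℕ} (ha : 0 < a)
    (hab : IsCoprime (a : ℤ) b) :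
    ∃ Y : YoungDiagram, Y.IsCore a ∧ Y.IsCore b ∧
      Y.card = ∑ i : Fin a, ∑ j : Fin a, inversionCount a (((i : ℤ) - j) * b) := by
  have ha' : (0 : ℤ) < a := by omega
  let S : ℕ → Prop := fun n => ∃ i : Fin a, ∃ m : ℕ, n = i * b + a * m
  have hinf : (Set.ofPred S).Infinite := by
    refine Set.infinite_of_injective_forall_mem (f := fun m : ℕ => a * m)
      (fun m n h => Nat.eq_of_mul_eq_mul_left ha h) fun m => ⟨⟨0, ha⟩, m, by simp⟩
  set F : ℤ := a * b - a - b with hF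
  let σ : ℕ → ℤ := fun j => (Nat.nth S j : ℤ)
  let β : ℕ → ℤ := fun i => F - σ i
  have hσ : StrictMono σ := fun i j h => Int.ofNat_lt.2 (Nat.nth_strictMono hinf h)
  have hβ : StrictAnti β := fun i j h => sub_lt_sub_left (hσ h) F
  have hσx (z : ℤ) : z ∈ Set.range σ ↔ ∃ i : Fin a, ∃ m : ℕ, z = (i : ℤ) * b + a * m := by
    constructor
    · rintro ⟨j, rfl⟩
      obtain ⟨i, m, h⟩ := Nat.nth_mem_of_infinite hinf j
      exact ⟨i, m, by simp only [σ, h]; push_cast; rfl⟩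
    · rintro ⟨i, m, rfl⟩
      have : i * b + a * m ∈ Set.range (Nat.nth S) := by
        rw [Nat.range_nth_of_infinite hinf]
        exact ⟨i, m, rfl⟩
      obtain ⟨j, hj⟩ := this
      exact ⟨j, by simp only [σ, hj]; push_cast; rfl⟩
  have hβx (z : ℤ) : z ∈ Set.range β ↔ ∃ i : Fin a, ∃ m : ℕ, z = (i : ℤ) * b - a * (m + 1) := by
    have : z ∈ Set.range β ↔ F - z ∈ Set.range σ := by
      simp only [Set.mem_range, β]
      exact exists_congr fun i => by constructor <;> intro h <;> linarith
    rw [this, hσx]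
    refine Fin.revPerm.exists_congr fun i => exists_congr fun m => ?_
    have : ((Fin.rev i : ℕ) : ℤ) = a - 1 - i := by rw [Fin.val_rev]; omega
    rw [Fin.revPerm_apply, this, hF]
    constructor <;> intro h <;> linarith
  have hx (i j : Fin a) (h : (a : ℤ) ∣ (i : ℤ) * b - (j : ℤ) * b) : i = j := by
    rw [← sub_mul] at h
    have := Int.eq_zero_of_abs_lt_dvd (hab.dvd_of_dvd_mul_right h) (by rw [abs_lt]; omega)
    omega
  have hc (z : ℤ) : z ∈ Set.range β ↔ z ∉ Set.range σ := by
    rw [hβx, hσx]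
    constructor
    · rintro ⟨i, m, rfl⟩ ⟨j, n, h⟩
      obtain rfl := hx i j ⟨n + m + 1, by linarith⟩
      have : (0 : ℤ) < a * (m + 1) := by positivity
      have : (0 : ℤ) ≤ a * n := by positivity
      omega
    · intro h
      obtain ⟨u, v, huv⟩ := hab
      have h0 := Int.emod_nonneg (z * v) ha'.ne'
      have h1 := Int.emod_lt_of_pos (z * v) ha'
      have h2 := Int.emod_add_mul_ediv (z * v) a
      obtain ⟨i, hi⟩ : ∃ i : Fin a, (i : ℤ) = z * v % a :=
        ⟨⟨(z * v % a).toNat, by omega⟩, Int.toNat_of_nonneg h0⟩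
      obtain ⟨c, hc⟩ : ∃ c : ℤ, z = (i : ℤ) * b + a * c := by
        refine ⟨z * u + z * v / a * b, ?_⟩
        rw [hi]
        linear_combination (-z) * huv - b * h2
      have hneg : c < 0 := by
        by_contra hn
        exact h ⟨i, c.toNat, by rw [Int.toNat_of_nonneg (by omega)]; exact hc⟩
      refine ⟨i, (-c - 1).toNat, ?_⟩
      rw [Int.toNat_of_nonneg (by omega)]
      linear_combination hc
  have hfin : {c : ℕ × ℕ | σ c.2 < β c.1}.Finite := by
    refine Set.Finite.subset
      (Finset.finite_toSet (Finset.range (F.toNat + 1) ×ˢ Finset.range (F.toNat + 1))) ?_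
    rintro ⟨i, j⟩ h
    have hi : (i : ℤ) ≤ σ i := Int.ofNat_le.2 (Nat.nth_strictMono hinf).le_apply
    have hj : (j : ℤ) ≤ σ j := Int.ofNat_le.2 (Nat.nth_strictMono hinf).le_apply
    simp only [Set.mem_ofPred_eq, β] at h
    simp only [Finset.coe_product, Set.mem_prod, Finset.mem_coe, Finset.mem_range]
    omega
  let Y : YoungDiagram :=
    { cells := hfin.toFinset
      isLowerSet := by
        rintro ⟨i, j⟩ ⟨i', j'⟩ h hm
        simp only [Set.Finite.coe_toFinset, Set.mem_ofPred_eq] at hm ⊢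
        exact (hσ.monotone h.2).trans_lt (hm.trans_le (hβ.antitone h.1)) }
  have hY (i j : ℕ) : (i, j) ∈ Y ↔ σ j < β i := by
    rw [← YoungDiagram.mem_cells]
    simp [Y]
  have hcore (t : ℕ) (ht : ∀ z ∈ Set.range σ, z + t ∈ Set.range σ) : Y.IsCore t := by
    rintro ⟨i, j⟩ hm h
    have := YoungDiagram.hookLength_eq hβ hσ hY hc hm
    refine (hc (β i)).1 ⟨i, rfl⟩ ?_
    convert ht _ ⟨j, rfl⟩ using 1
    simp only at h
    omega
  refine ⟨Y, hcore a fun z hz => ?_, hcore b fun z hz => ?_, ?_⟩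
  · obtain ⟨i, m, rfl⟩ := (hσx z).1 hz
    exact (hσx _).2 ⟨i, m + 1, by push_cast; ring⟩
  · obtain ⟨i, m, rfl⟩ := (hσx z).1 hz
    rw [hσx]
    by_cases hi : (i : ℕ) + 1 < a
    · exact ⟨⟨i + 1, hi⟩, m, by push_cast; ring⟩
    · have : ((i : ℕ) : ℤ) = a - 1 := by omega
      exact ⟨⟨0, ha⟩, m + b, by rw [this]; push_cast; ring⟩
  · rw [Y.card_eq_sum_inversionCount ha hβ.injective hσ.injective hY hx hβx hσx]
    simp only [sub_mul]

theorem sum_range_sum_range_sub (f : ℤ → ℕ) (hf : ∀ d ≤ 0, f d = 0) (n : ℕ) :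
    ∑ i ∈ Finset.range n, ∑ j ∈ Finset.range n, f ((i : ℤ) - j) =
      ∑ i ∈ Finset.range n, ∑ d ∈ Finset.range (i + 1), f d := by
  refine Finset.sum_congr rfl fun i hi => ?_
  rw [← Finset.sum_range_reflect (fun d : ℕ => f d)]
  have hsub : Finset.range (i + 1) ⊆ Finset.range n := by
    intro j
    simp only [Finset.mem_range] at hi ⊢
    omega
  rw [← Finset.sum_subset hsub]
  · refine Finset.sum_congr rfl fun j hj => ?_
    rw [Finset.mem_range] at hj
    congr 1
    omega
  · intro j _ hj
    rw [Finset.mem_range] at hj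
    exact hf _ (by omega)

theorem three_mul_sum_triangular (k : ℕ) :
    3 * ∑ j ∈ Finset.range (k + 1), 2 * (j * (j + 1) / 2) = k * (k + 1) * (k + 2) := by
  induction k with
  | zero => rfl
  | succ k ih =>
    rw [Finset.sum_range_succ, mul_add, ih, Nat.mul_div_cancel' (Nat.even_mul_succ_self _).two_dvd]
    ring

theorem sum_inversionCount_odd (n : ℕ) :
    ∑ i : Fin (2 * n + 1), ∑ j : Fin (2 * n + 1),
      inversionCount (2 * n + 1) (((i : ℤ) - j) * (2 * n + 3 : ℕ)) =
    2 * (n + 1) * ∑ j ∈ Finset.range (n + 1), 2 * (j * (j + 1) / 2) := by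
  set f : ℤ → ℕ := fun d => inversionCount (2 * n + 1) (d * (2 * n + 3 : ℕ)) with hf
  have hf0 (d : ℤ) (hd : d ≤ 0) : f d = 0 :=
    inversionCount_of_nonpos (mul_nonpos_of_nonpos_of_nonneg hd (by positivity))
  have hsmall (d : ℕ) (hd : d ≤ n) : 2 * f d = d * (d + 1) := by
    rcases Nat.eq_zero_or_pos d with rfl | hpos
    · simp [hf0]
    · refine two_mul_inversionCount d ?_ ?_ <;> push_cast <;> nlinarith
  have hlarge (d : ℕ) (hd : d < n) : 2 * f (n + d + 1 : ℕ) = (n + d + 2) * (n + d + 3) := by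
    refine two_mul_inversionCount (n + d + 2) ?_ ?_ <;> push_cast <;> nlinarith
  have P1 (i : ℕ) (hi : i ≤ n) :
      6 * ∑ d ∈ Finset.range (i + 1), f (d : ℕ) = i * (i + 1) * (i + 2) := by
    induction i with
    | zero => simp [hf0]
    | succ i ih =>
      rw [Finset.sum_range_succ, mul_add, ih (by omega)]
      linear_combination 3 * hsmall (i + 1) hi
  have P2 (i : ℕ) (hi : i ≤ n) :
      6 * ∑ d ∈ Finset.range (n + i + 1), f (d : ℕ) + 3 * (n + 1) * (n + 2) =
        (n + i + 1) * (n + i + 2) * (n + i + 3) := by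
    induction i with
    | zero =>
      rw [add_zero, P1 n le_rfl]
      ring
    | succ i ih =>
      rw [← add_assoc, Finset.sum_range_succ]
      linear_combination ih (by omega) + 3 * hlarge i (by omega)
  have Q1 (i : ℕ) (hi : i ≤ n) :
      24 * ∑ r ∈ Finset.range (i + 1), ∑ d ∈ Finset.range (r + 1), f (d : ℕ) =
        i * (i + 1) * (i + 2) * (i + 3) := by
    induction i with
    | zero => simp [hf0]
    | succ i ih =>
      rw [Finset.sum_range_succ, mul_add, ih (by omega)]
      linear_combination 4 * P1 (i + 1) hi
  have Q2 (i : ℕ) (hi : i ≤ n) :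
      24 * ∑ r ∈ Finset.range (n + i + 1), ∑ d ∈ Finset.range (r + 1), f (d : ℕ) +
          12 * i * (n + 1) * (n + 2) + 4 * (n + 1) * (n + 2) * (n + 3) =
        (n + i + 1) * (n + i + 2) * (n + i + 3) * (n + i + 4) := by
    induction i with
    | zero =>
      rw [add_zero, Q1 n le_rfl]
      ring
    | succ i ih =>
      rw [← add_assoc, Finset.sum_range_succ]
      linear_combination ih (by omega) + 4 * P2 (i + 1) hi
  have hsum := sum_range_sum_range_sub f hf0 (2 * n + 1)
  rw [Finset.sum_range] at hsum
  simp only [Finset.sum_range (n := 2 * n + 1)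
    (f := fun j : ℕ => f (_ - (j : ℤ)))] at hsum
  rw [hsum]
  have h1 := Q2 n le_rfl
  have h2 := three_mul_sum_triangular n
  rw [← two_mul] at h1
  generalize ∑ j ∈ Finset.range (n + 1), 2 * (j * (j + 1) / 2) = T at h2 ⊢
  generalize ∑ r ∈ Finset.range (2 * n + 1), ∑ d ∈ Finset.range (r + 1), f (d : ℕ) = U at h1 ⊢
  zify at h1 h2 ⊢
  have : 24 * (U : ℤ) = 24 * (2 * (n + 1) * T) := by linear_combination h1 - 16 * (n + 1 : ℤ) * h2
  linarith

theorem max_two_core_eq_quotient_sum (k : ℕ) (hk : 1 ≤ k) :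
    IsGreatest {n : ℕ | ∃ Y : YoungDiagram,
        Y.IsCore (2 * k - 1) ∧ Y.IsCore (2 * k + 1) ∧ Y.card = n}
      (2 * k * ∑ j ∈ Finset.range k, 2 * (j * (j + 1) / 2)) := by
  obtain ⟨n, rfl⟩ := Nat.exists_eq_add_of_le' hk
  rw [show 2 * (n + 1) - 1 = 2 * n + 1 by omega, show 2 * (n + 1) + 1 = 2 * n + 3 by omega,
    ← sum_inversionCount_odd]
  have hab : IsCoprime ((2 * n + 1 : ℕ) : ℤ) (2 * n + 3 : ℕ) :=
    ⟨n + 1, -n, by push_cast; ring⟩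
  refine ⟨YoungDiagram.exists_isCore_card_eq (by omega) hab, ?_⟩
  rintro _ ⟨Y, hYa, hYb, rfl⟩
  exact YoungDiagram.card_le_of_isCore (by omega) (by omega) hab hYa hYb
end

section
/- Let s_1, s_2, …, s_n be positive integers (n ≥ 1). Then the set of partitions that are simultaneously s_i-cores for all i = 1, …, n is finite if and only if gcd(s_1, s_2, …, s_n) = 1. -/
namespace YoungDiagram

/-- The bead positions `λ_i - i` (with `i` 0-indexed) of the Maya diagram of a partition `λ`. -/
def beads (Y : YoungDiagram) : Set ℤ :=
  Set.range fun i : ℕ => (Y.rowLen i : ℤ) - i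

theorem lt_rowLen_iff_lt_colLen (Y : YoungDiagram) (i j : ℕ) : j < Y.rowLen i ↔ i < Y.colLen j :=
  mem_iff_lt_rowLen.symm.trans mem_iff_lt_colLen

/-- Positions without a bead are indexed by columns. -/
theorem exists_colLen_of_notMem_beads {Y : YoungDiagram} {x : ℤ} (hx : x ∉ Y.beads) :
    ∃ j : ℕ, (j : ℤ) - Y.colLen j + 1 = x := by
  classical
  have hne (i : ℕ) : (Y.rowLen i : ℤ) - i ≠ x := fun h => hx ⟨i, h⟩
  have hex : ∃ i : ℕ, (Y.rowLen i : ℤ) - i ≤ x := by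
    refine ⟨Y.rowLen 0 + x.natAbs, ?_⟩
    have := Y.rowLen_anti 0 (Y.rowLen 0 + x.natAbs) (Nat.zero_le _)
    omega
  obtain ⟨i, hi, hmin⟩ : ∃ i : ℕ, (Y.rowLen i : ℤ) - i ≤ x ∧
      ∀ k < i, ¬ (Y.rowLen k : ℤ) - k ≤ x :=
    ⟨Nat.find hex, Nat.find_spec hex, fun _ h => Nat.find_min hex h⟩
  have hi' := hne i
  refine ⟨(x + i - 1).toNat, ?_⟩
  have hupper := Y.lt_rowLen_iff_lt_colLen i (x + i - 1).toNat
  rcases i with _ | k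
  · omega
  · have hk := hmin k k.lt_succ_self
    have hlower := Y.lt_rowLen_iff_lt_colLen k (x + (k + 1 : ℕ) - 1).toNat
    omega

theorem colLen_notMem_beads (Y : YoungDiagram) (j : ℕ) :
    (j : ℤ) - Y.colLen j + 1 ∉ Y.beads := by
  rintro ⟨i, hi⟩
  have := Y.lt_rowLen_iff_lt_colLen i j
  dsimp only at hi
  omega

theorem IsCore.sub_mem_beads {Y : YoungDiagram} {t : ℕ} (hY : Y.IsCore t) {x : ℤ}
    (hx : x ∈ Y.beads) : x - t ∈ Y.beads := by
  by_contra h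
  obtain ⟨i, rfl⟩ := id hx
  obtain ⟨j, hj⟩ := exists_colLen_of_notMem_beads h
  dsimp only at hj
  have hij := Y.lt_rowLen_iff_lt_colLen i j
  rcases Nat.eq_zero_or_pos t with rfl | ht
  · simp_all
  · have hlt : j < Y.rowLen i := by omega
    refine hY (i, j) ((mem_cells _).2 (mem_iff_lt_rowLen.2 hlt)) ?_
    simp only [hookLength]
    omega

theorem sub_mem_beads_of_mem_closure {Y : YoungDiagram} {S : Set ℕ} (hY : ∀ t ∈ S, Y.IsCore t)
    {m : ℕ} (hm : m ∈ AddSubmonoid.closure S) {x : ℤ} (hx : x ∈ Y.beads) :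
    x - m ∈ Y.beads := by
  induction hm using AddSubmonoid.closure_induction generalizing x with
  | mem t ht => exact (hY t ht).sub_mem_beads hx
  | zero => simpa using hx
  | add a b _ _ iha ihb =>
    have := ihb (iha hx)
    rwa [sub_sub, ← Nat.cast_add] at this

theorem finite_setOfPred_rowLen_le_colLen_le (a b : ℕ) :
    {Y : YoungDiagram | Y.rowLen 0 ≤ a ∧ Y.colLen 0 ≤ b}.Finite := by
  refine Set.Finite.of_finite_image (f := cells) ?_ fun Y _ Z _ h => YoungDiagram.ext h
  refine (Finset.range b ×ˢ Finset.range a).powerset.finite_toSet.subset ?_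
  rintro _ ⟨Y, ⟨ha, hb⟩, rfl⟩
  rw [Finset.mem_coe, Finset.mem_powerset]
  rintro ⟨i, j⟩ hc
  have hrow := mem_iff_lt_rowLen.1 ((mem_cells _).1 hc)
  have hcol := mem_iff_lt_colLen.1 ((mem_cells _).1 hc)
  have := Y.rowLen_anti 0 i (Nat.zero_le _)
  have := Y.colLen_anti 0 j (Nat.zero_le _)
  simp only [Finset.mem_product, Finset.mem_range]
  omega

/-- If the gcd of `S` is 1, then only finitely many partitions are `t`-cores for all
`t ∈ S`. -/
theorem finite_setOfPred_isCore_of_setGcd_eq_one {S : Set ℕ} (hS : Nat.setGcd S = 1) :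
    {Y : YoungDiagram | ∀ t ∈ S, Y.IsCore t}.Finite := by
  obtain ⟨N, hN⟩ := Nat.exists_mem_closure_of_ge S
  refine (finite_setOfPred_rowLen_le_colLen_le N N).subset fun Y hY => ?_
  have hcorner := Y.lt_rowLen_iff_lt_colLen 0 0
  have hhook : Y.rowLen 0 = 0 ∨ Y.rowLen 0 + Y.colLen 0 - 1 < N := by
    by_contra! h
    have hmem := sub_mem_beads_of_mem_closure hY (hN _ h.2 (by simp [hS]))
      (x := Y.rowLen 0) (Set.mem_range.2 ⟨0, by simp⟩)
    refine Y.colLen_notMem_beads 0 ?_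
    convert hmem using 1
    omega
  rw [Set.mem_ofPred_eq]
  omega

/-- The partition `(k * e, (k - 1) * e, …, e)`, for positive `e`. -/
def multipleStaircase (e k : ℕ) : YoungDiagram where
  cells := {c ∈ Finset.range k ×ˢ Finset.range (k * e) | c.1 + c.2 / e < k}
  isLowerSet := by
    rintro ⟨i, j⟩ ⟨i', j'⟩ ⟨hi, hj⟩ h
    simp only [Finset.coe_filter, Finset.mem_product, Finset.mem_range, Set.mem_ofPred_eq] at *
    have := Nat.div_le_div_right (c := e) hj
    omega

theorem mem_multipleStaircase {e : ℕ} (he : 0 < e) {k i j : ℕ} :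
    (i, j) ∈ multipleStaircase e k ↔ i + j / e < k := by
  rw [← mem_cells]
  simp only [multipleStaircase, Finset.mem_filter, Finset.mem_product, Finset.mem_range]
  have := Nat.div_lt_iff_lt_mul he (x := j) (y := k)
  generalize j / e = q at *
  omega

theorem colLen_multipleStaircase {e : ℕ} (he : 0 < e) (k j : ℕ) :
    (multipleStaircase e k).colLen j = k - j / e := by
  refine eq_of_forall_lt_iff fun i => ?_
  rw [← mem_iff_lt_colLen, mem_multipleStaircase he]
  generalize j / e = q
  omega

theorem rowLen_multipleStaircase {e : ℕ} (he : 0 < e) (k i : ℕ) :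
    (multipleStaircase e k).rowLen i = (k - i) * e := by
  refine eq_of_forall_lt_iff fun j => ?_
  rw [← mem_iff_lt_rowLen, mem_multipleStaircase he, ← Nat.div_lt_iff_lt_mul he]
  generalize j / e = q
  omega

theorem multipleStaircase_injective {e : ℕ} (he : 0 < e) :
    Function.Injective (multipleStaircase e) := fun k l h => by
  simpa [colLen_multipleStaircase he] using congrArg (colLen · 0) h

theorem isCore_multipleStaircase {e : ℕ} (he : 0 < e) (k : ℕ) {t : ℕ} (ht : e + 1 ∣ t) :
    (multipleStaircase e k).IsCore t := by
  rintro ⟨i, j⟩ hc rfl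
  have hlt := (mem_multipleStaircase he).1 ((mem_cells _).1 hc)
  simp only [hookLength, rowLen_multipleStaircase he, colLen_multipleStaircase he] at ht
  obtain ⟨p, rfl⟩ := Nat.exists_eq_add_of_lt hlt
  have hmod := Nat.mod_lt j he
  have hj := Nat.div_add_mod j e
  clear hc
  generalize j / e = q at *
  generalize j % e = r at *
  have hrow : (i + q + p + 1 - i) * e = e * q + p * e + e := by
    rw [show i + q + p + 1 - i = q + p + 1 by omega]
    ring
  have hhook : (i + q + p + 1 - i) * e - j + (i + q + p + 1 - q - i) - 1
      = (e + 1) * p + (e - r) := by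
    rw [hrow, show (e + 1) * p = p * e + p by ring]
    omega
  rw [hhook, Nat.dvd_add_right (dvd_mul_right _ _)] at ht
  have := Nat.le_of_dvd (by omega) ht
  omega

end YoungDiagram

theorem finite_simultaneous_cores_iff (n : ℕ) (hn : 1 ≤ n) (s : Fin n → ℕ)
    (hs : ∀ i, 0 < s i) :
    {Y : YoungDiagram | ∀ i, Y.IsCore (s i)}.Finite ↔ Finset.univ.gcd s = 1 := by
  constructor
  · intro hfin
    by_contra hne
    have hpos : 0 < Finset.univ.gcd s := by
      refine Nat.pos_of_ne_zero fun h => ?_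
      exact (hs ⟨0, hn⟩).ne' (Finset.gcd_eq_zero_iff.1 h _ (Finset.mem_univ _))
    obtain ⟨e, he⟩ : ∃ e, Finset.univ.gcd s = e + 1 := ⟨_, (Nat.succ_pred hpos.ne').symm⟩
    have he0 : 0 < e := by omega
    refine Set.infinite_range_of_injective (YoungDiagram.multipleStaircase_injective he0)
      (hfin.subset ?_)
    rintro _ ⟨k, rfl⟩ i
    exact YoungDiagram.isCore_multipleStaircase he0 k
      (he ▸ Finset.gcd_dvd (Finset.mem_univ i))
  · intro hgcd
    have hS : Nat.setGcd (Set.range s) = 1 := by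
      refine Nat.dvd_one.1 (hgcd ▸ Finset.dvd_gcd fun i _ => ?_)
      exact Nat.setGcd_dvd_of_mem (Set.mem_range_self i)
    simpa using YoungDiagram.finite_setOfPred_isCore_of_setGcd_eq_one hS
end

section
/- For every integer k ≥ 1, there is no simultaneous (2k, 2k+2)-core partition κ with the property that the Young diagram of every simultaneous (2k, 2k+2)-core is contained in the Young diagram of κ; that is, a maximal (2k, 2k+2)-core does not exist. -/
namespace YoungDiagram

/-- The staircase diagram with rows `n, n - 1, …, 1`. -/
def staircase (n : ℕ) : YoungDiagram where
  cells := (Finset.range n ×ˢ Finset.range n).filter fun c => c.1 + c.2 < n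
  isLowerSet := by
    rintro ⟨a, b⟩ ⟨c, d⟩ h hab
    obtain ⟨h₁, h₂⟩ := Prod.mk_le_mk.mp h
    simp only [Finset.coe_filter, Finset.mem_product, Finset.mem_range, Set.mem_ofPred_eq]
      at hab ⊢
    omega

theorem mem_staircase {n i j : ℕ} : (i, j) ∈ staircase n ↔ i + j < n := by
  rw [← mem_cells]
  simp only [staircase, Finset.mem_filter, Finset.mem_product, Finset.mem_range]
  omega

theorem rowLen_staircase (n i : ℕ) : (staircase n).rowLen i = n - i :=
  eq_of_forall_lt_iff fun j => by
    rw [← mem_iff_lt_rowLen, mem_staircase]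
    omega

theorem colLen_staircase (n j : ℕ) : (staircase n).colLen j = n - j :=
  eq_of_forall_lt_iff fun i => by
    rw [← mem_iff_lt_colLen, mem_staircase]
    omega

/-- All hook lengths of a staircase are odd, so it is a `t`-core for every even `t`. -/
theorem isCore_staircase (n : ℕ) {t : ℕ} (ht : Even t) : (staircase n).IsCore t := by
  rintro ⟨i, j⟩ hc
  rw [mem_cells, mem_staircase] at hc
  obtain ⟨m, rfl⟩ := ht
  simp only [hookLength, rowLen_staircase, colLen_staircase]
  omega

end YoungDiagram

theorem no_maximal_even_core (k : ℕ) (hk : 1 ≤ k) :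
    ¬ ∃ κ : YoungDiagram, κ.IsCore (2 * k) ∧ κ.IsCore (2 * k + 2) ∧
      ∀ μ : YoungDiagram, μ.IsCore (2 * k) → μ.IsCore (2 * k + 2) → μ ≤ κ := by
  rintro ⟨κ, -, -, hκ⟩
  have hle := hκ (YoungDiagram.staircase (κ.rowLen 0 + 1))
    (YoungDiagram.isCore_staircase _ (even_two_mul k))
    (YoungDiagram.isCore_staircase _ ((even_two_mul k).add even_two))
  have hmem : (0, κ.rowLen 0) ∈ κ := hle (YoungDiagram.mem_staircase.mpr (by omega))
  exact lt_irrefl _ (YoungDiagram.mem_iff_lt_rowLen.mp hmem)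
end
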